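/- (Lemma 2.) Let ω > 0 and m > 0, set κ := ω/m and C := e^ω/(1 − e^{−3ω}). Then there exist constants A ≥ 0 and B ≥ 0 such that for every real T ≥ 3, the finite sum over natural numbers t with max(3, ⌈log(T)/κ⌉) ≤ t ≤ ⌊T⌋ of C · e^{−κ·t/log(t)} · (1 − e^{−tω}) is at most A·log(T) + B. In particular this sum is O(log T). -/

import Mathlib

lemma beta_term_aux (k : ℝ) (hk : 0 < k) (t : ℕ) (ht : 3 ≤ t) :
    Real.exp (-k * (t : ℝ) / Real.log (t : ℝ)) ≤ (384 / k ^ 4) * (1 / (t : ℝ) ^ 2) := by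
  have ht' : (3 : ℝ) ≤ t := by exact_mod_cast ht
  have hlog : 0 < Real.log (t : ℝ) := Real.log_pos (by linarith)
  set s := Real.sqrt (t : ℝ) with hs
  have hs0 : 0 < s := Real.sqrt_pos.mpr (by linarith)
  have hss : s ^ 2 = t := Real.sq_sqrt (by linarith)
  have hl : Real.log (t : ℝ) ≤ 2 * s := by
    rw [← hss, Real.log_pow]
    have := Real.log_le_sub_one_of_pos hs0
    push_cast
    linarith
  have hx : k * s / 2 ≤ k * t / Real.log t := by
    rw [div_le_div_iff₀ (by norm_num) hlog, ← hss]
    rw [← hss] at hl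
    nlinarith [mul_le_mul_of_nonneg_left hl (mul_pos hk hs0).le]
  have hy : 0 < k * s / 2 := by positivity
  have h1 : Real.exp (-k * (t : ℝ) / Real.log (t : ℝ)) ≤ Real.exp (-(k * s / 2)) := by
    apply Real.exp_le_exp.mpr
    have : -k * (t : ℝ) / Real.log (t : ℝ) = -(k * t / Real.log t) := by ring
    rw [this]
    linarith
  have h2 := Real.pow_div_factorial_le_exp (k * s / 2) hy.le 4
  have h3 : Real.exp (-(k * s / 2)) ≤ ((k * s / 2) ^ 4 / (Nat.factorial 4 : ℝ))⁻¹ := by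
    rw [Real.exp_neg]
    exact inv_anti₀ (by positivity) h2
  refine (h1.trans h3).trans (le_of_eq ?_)
  rw [← hss]
  norm_num [Nat.factorial]
  field_simp
  norm_num

/-- Lemma 2: the quantity `β(T, ω, C)` is `O(log T)`: there are constants `A, B ≥ 0`
such that for all `T ≥ 3`,
`Σ_{t = max(3, ⌈log T/κ⌉)}^{⌊T⌋} C e^{-κt/log t}(1 - e^{-tω}) ≤ A log T + B`,
where `κ = ω/m` and `C = e^ω/(1 - e^{-3ω})`. -/
theorem beta_is_O_log (ω m : ℝ) (hω : 0 < ω) (hm : 0 < m) :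
    ∃ A B : ℝ, 0 ≤ A ∧ 0 ≤ B ∧ ∀ T : ℝ, 3 ≤ T →
      ∑ t ∈ Finset.Icc (max 3 ⌈Real.log T / (ω / m)⌉₊) ⌊T⌋₊,
          (Real.exp ω / (1 - Real.exp (-3 * ω))) *
            Real.exp (-(ω / m) * (t : ℝ) / Real.log (t : ℝ)) *
            (1 - Real.exp (-((t : ℝ) * ω))) ≤
        A * Real.log T + B := by
  have hk : 0 < ω / m := div_pos hω hm
  have hD : 0 < 1 - Real.exp (-3 * ω) := by
    have : Real.exp (-3 * ω) < 1 := Real.exp_lt_one_iff.mpr (by linarith)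
    linarith
  set C := Real.exp ω / (1 - Real.exp (-3 * ω)) with hC
  have hC0 : 0 < C := div_pos (Real.exp_pos _) hD
  set k := ω / m with hkdef
  have hsum : Summable (fun t : ℕ => C * ((384 / k ^ 4) * (1 / (t : ℝ) ^ 2))) :=
    ((Real.summable_one_div_nat_pow.mpr (by norm_num)).mul_left _).mul_left _
  have hnn : ∀ t : ℕ, 0 ≤ C * ((384 / k ^ 4) * (1 / (t : ℝ) ^ 2)) := fun t => by positivity
  refine ⟨0, ∑' t : ℕ, C * ((384 / k ^ 4) * (1 / (t : ℝ) ^ 2)), le_rfl, tsum_nonneg hnn, ?_⟩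
  intro T _
  rw [zero_mul, zero_add]
  refine le_trans (Finset.sum_le_sum ?_) (hsum.sum_le_tsum _ (fun t _ => hnn t))
  intro t ht
  have ht3 : 3 ≤ t := le_trans (le_max_left _ _) (Finset.mem_Icc.mp ht).1
  have h1 := mul_le_mul_of_nonneg_left (beta_term_aux k hk t ht3) hC0.le
  refine le_trans (mul_le_of_le_one_right (by positivity) ?_) h1
  linarith [Real.exp_pos (-((t : ℝ) * ω))]
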